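/- The Jacobi sum [[(ξ,0),(ξ′,0)],(0,η)] + [[(ξ′,0),(0,η)],(ξ,0)] + [[(0,η),(ξ,0)],(ξ′,0)] for the extended bracket vanishes for all ξ,ξ′ ∈ 𝔤 and η ∈ 𝔥 if and only if conditions (E5) and (E6) hold for all ξ,ξ′ ∈ 𝔤 and η ∈ 𝔥. -/

import Mathlib

/-- The extended bracket on `G × H` built from the data `(▷, ◁, Φ, κ)`. -/
def extBracket {𝕜 G H : Type*} [Field 𝕜] [LieRing G] [LieAlgebra 𝕜 G]
    [AddCommGroup H] [Module 𝕜 H]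
    (tr : H →ₗ[𝕜] G →ₗ[𝕜] G) (tl : H →ₗ[𝕜] G →ₗ[𝕜] H)
    (Φ : H →ₗ[𝕜] H →ₗ[𝕜] G) (κ : H →ₗ[𝕜] H →ₗ[𝕜] H)
    (x y : G × H) : G × H :=
  (⁅x.1, y.1⁆ + tr x.2 y.1 - tr y.2 x.1 + Φ x.2 y.2,
    κ x.2 y.2 + tl x.2 y.1 - tl y.2 x.1)

/-- The mixed Jacobi sum measures the failure of the two compatibility conditions. -/
theorem extBracket_mixed_jacobi_sum
    {𝕜 G H : Type*} [Field 𝕜] [LieRing G] [LieAlgebra 𝕜 G]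
    [AddCommGroup H] [Module 𝕜 H]
    (tr : H →ₗ[𝕜] G →ₗ[𝕜] G) (tl : H →ₗ[𝕜] G →ₗ[𝕜] H)
    (Φ : H →ₗ[𝕜] H →ₗ[𝕜] G) (κ : H →ₗ[𝕜] H →ₗ[𝕜] H) (ξ ξ' : G) (η : H) :
    extBracket tr tl Φ κ (extBracket tr tl Φ κ (ξ, 0) (ξ', 0)) (0, η)
        + extBracket tr tl Φ κ (extBracket tr tl Φ κ (ξ', 0) (0, η)) (ξ, 0)
        + extBracket tr tl Φ κ (extBracket tr tl Φ κ (0, η) (ξ, 0)) (ξ', 0) =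
      (⁅ξ, tr η ξ'⁆ - ⁅ξ', tr η ξ⁆ + tr (tl η ξ) ξ' - tr (tl η ξ') ξ - tr η ⁅ξ, ξ'⁆,
        tl (tl η ξ) ξ' - tl (tl η ξ') ξ - tl η ⁅ξ, ξ'⁆) := by
  have hskew : ⁅tr η ξ, ξ'⁆ = -⁅ξ', tr η ξ⁆ := (lie_skew _ _).symm
  have hskew' : ⁅tr η ξ', ξ⁆ = -⁅ξ, tr η ξ'⁆ := (lie_skew _ _).symm
  ext
  · simp [extBracket, hskew, hskew', -lie_skew]
    abel
  · simp [extBracket]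
    abel

/-- The Jacobi sum
`[[(ξ,0),(ξ′,0)],(0,η)] + [[(ξ′,0),(0,η)],(ξ,0)] + [[(0,η),(ξ,0)],(ξ′,0)]`
for the extended bracket vanishes for all `ξ, ξ′ ∈ G`, `η ∈ H` iff
conditions (E5) and (E6) hold. -/
theorem extended_bracket_mixed_jacobi_iff_E5_E6
    {𝕜 G H : Type*} [Field 𝕜] [LieRing G] [LieAlgebra 𝕜 G]
    [AddCommGroup H] [Module 𝕜 H]
    (tr : H →ₗ[𝕜] G →ₗ[𝕜] G) (tl : H →ₗ[𝕜] G →ₗ[𝕜] H)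
    (Φ : H →ₗ[𝕜] H →ₗ[𝕜] G) (κ : H →ₗ[𝕜] H →ₗ[𝕜] H) :
    (∀ (ξ ξ' : G) (η : H),
      extBracket tr tl Φ κ (extBracket tr tl Φ κ (ξ, 0) (ξ', 0)) (0, η)
        + extBracket tr tl Φ κ (extBracket tr tl Φ κ (ξ', 0) (0, η)) (ξ, 0)
        + extBracket tr tl Φ κ (extBracket tr tl Φ κ (0, η) (ξ, 0)) (ξ', 0) = 0) ↔
    ((∀ (ξ ξ' : G) (η : H),
        tr η ⁅ξ, ξ'⁆ = ⁅ξ, tr η ξ'⁆ - ⁅ξ', tr η ξ⁆ + tr (tl η ξ) ξ' - tr (tl η ξ') ξ) ∧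
      (∀ (ξ ξ' : G) (η : H),
        tl η ⁅ξ, ξ'⁆ = tl (tl η ξ) ξ' - tl (tl η ξ') ξ)) := by
  simp only [extBracket_mixed_jacobi_sum, Prod.mk_eq_zero, sub_eq_zero, forall_and]
  simp only [eq_comm]
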